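/- Let (X,T) be a pointwise ergodic topological dynamical system. The generic-point partition 𝒫 has closed atoms and is upper semicontinuous if and only if there exists a compact metric space Y and a continuous surjection π : X → Y with π ∘ T = π such that for each y ∈ Y the fiber π⁻¹(y) is a closed invariant uniquely ergodic set. -/

import Mathlib

open MeasureTheory Filter Topology Metric

section TopDefs

variable {X : Type*} [MetricSpace X]

/-- The Cesàro (Birkhoff) averages `(1/n) ∑_{i<n} f(Tⁱ x)`. -/
noncomputable def cesaro (T : X → X) (f : X → ℝ) (n : ℕ) (x : X) : ℝ :=
  (n : ℝ)⁻¹ * ∑ i ∈ Finset.range n, f (T^[i] x)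

/-- `P` is a partition of `X` (into nonempty sets, every point in exactly one atom). -/
def IsPartition (P : Set (Set X)) : Prop :=
  (∀ A ∈ P, A.Nonempty) ∧ ∀ x : X, ∃! A : Set X, A ∈ P ∧ x ∈ A

/-- A partition is upper semicontinuous if whenever a sequence of atoms converges in the
Hausdorff metric to a (nonempty compact) set `S`, then `S` is contained in some atom. -/
def PartitionUSC (P : Set (Set X)) : Prop :=
  ∀ A : ℕ → Set X, (∀ n, A n ∈ P) → ∀ S : Set X, S.Nonempty → IsCompact S →
    Tendsto (fun n => hausdorffDist (A n) S) atTop (𝓝 0) → ∃ B ∈ P, S ⊆ B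

/-- A partition is lower semicontinuous if whenever a sequence of atoms converges in the
Hausdorff metric to a (nonempty compact) set `S`, then `S` contains some atom. -/
def PartitionLSC (P : Set (Set X)) : Prop :=
  ∀ A : ℕ → Set X, (∀ n, A n ∈ P) → ∀ S : Set X, S.Nonempty → IsCompact S →
    Tendsto (fun n => hausdorffDist (A n) S) atTop (𝓝 0) → ∃ B ∈ P, B ⊆ S

/-- Upper semicontinuity of a (compact-)set-valued function: if `yₙ → y₀` and
`f(yₙ) → S` in the Hausdorff metric, then `S ⊆ f(y₀)`. -/
def SetValuedUSC {Y : Type*} [MetricSpace Y] (f : Y → Set X) : Prop :=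
  ∀ (y : ℕ → Y) (y₀ : Y), Tendsto y atTop (𝓝 y₀) →
    ∀ S : Set X, S.Nonempty → IsCompact S →
      Tendsto (fun n => hausdorffDist (f (y n)) S) atTop (𝓝 0) → S ⊆ f y₀

/-- Lower semicontinuity of a (compact-)set-valued function: if `yₙ → y₀` and
`f(yₙ) → S` in the Hausdorff metric, then `f(y₀) ⊆ S`. -/
def SetValuedLSC {Y : Type*} [MetricSpace Y] (f : Y → Set X) : Prop :=
  ∀ (y : ℕ → Y) (y₀ : Y), Tendsto y atTop (𝓝 y₀) →
    ∀ S : Set X, S.Nonempty → IsCompact S →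
      Tendsto (fun n => hausdorffDist (f (y n)) S) atTop (𝓝 0) → f y₀ ⊆ S

/-- A set is invariant for the homeomorphism `T` if `T(K) = K`. -/
def IsInvariantSet (T : X ≃ₜ X) (K : Set X) : Prop := T '' K = K

/-- A minimal set: nonempty, closed, invariant, with no proper nonempty closed invariant
subset. -/
def IsMinimalSet (T : X ≃ₜ X) (K : Set X) : Prop :=
  K.Nonempty ∧ IsClosed K ∧ IsInvariantSet T K ∧
    ∀ K' : Set X, K' ⊆ K → K'.Nonempty → IsClosed K' → IsInvariantSet T K' → K' = K

/-- A system is semi-simple if `X` is a union of minimal sets. -/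
def SemiSimple (T : X ≃ₜ X) : Prop :=
  ∀ x : X, ∃ K : Set X, IsMinimalSet T K ∧ x ∈ K

/-- A system is uniform if the Cesàro means of every continuous function converge
uniformly on `X`. -/
def UniformSystem (T : X ≃ₜ X) : Prop :=
  ∀ f : C(X, ℝ), ∃ g : X → ℝ,
    TendstoUniformly (fun n x => cesaro (⇑T) (⇑f) n x) g atTop

/-- Uniformity of the subsystem carried by the set `M`: the Cesàro means of every
continuous function converge uniformly on `M`. -/
def UniformOn (T : X ≃ₜ X) (M : Set X) : Prop :=
  ∀ f : C(X, ℝ), ∃ g : X → ℝ,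
    TendstoUniformlyOn (fun n x => cesaro (⇑T) (⇑f) n x) g atTop M

/-- Strictly uniform = uniform + semi-simple. -/
def StrictlyUniform (T : X ≃ₜ X) : Prop := UniformSystem T ∧ SemiSimple T

end TopDefs

section MeasDefs

variable {X : Type*} [MetricSpace X] [CompactSpace X]
  [MeasurableSpace X] [BorelSpace X]

/-- A `T`-invariant Borel probability measure. -/
def IsInvariantMeasure (T : X ≃ₜ X) (μ : ProbabilityMeasure X) : Prop :=
  μ.toMeasure.map ⇑T = μ.toMeasure

/-- An ergodic `T`-invariant Borel probability measure. -/
def IsErgodicMeasure (T : X ≃ₜ X) (μ : ProbabilityMeasure X) : Prop :=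
  Ergodic (⇑T) μ.toMeasure

/-- `x` is generic for `μ`: the Cesàro means of every continuous function at `x`
converge to the integral of the function against `μ`. -/
def IsGenericFor (T : X ≃ₜ X) (x : X) (μ : ProbabilityMeasure X) : Prop :=
  ∀ f : C(X, ℝ),
    Tendsto (fun n => cesaro (⇑T) (⇑f) n x) atTop (𝓝 (∫ y, f y ∂μ.toMeasure))

/-- Pointwise ergodic: every point is generic for some ergodic measure. -/
def PointwiseErgodic (T : X ≃ₜ X) : Prop :=
  ∀ x : X, ∃ μ : ProbabilityMeasure X, IsErgodicMeasure T μ ∧ IsGenericFor T x μ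

/-- The set of points generic for `μ` (a fiber of the map `Φ`). -/
def genericFiber (T : X ≃ₜ X) (μ : ProbabilityMeasure X) : Set X :=
  {x : X | IsGenericFor T x μ}

/-- The generic-point partition `𝒫`: the (nonempty) fibers of the map `Φ` sending each
point to the ergodic measure it generates. -/
def genericPartition (T : X ≃ₜ X) : Set (Set X) :=
  {A : Set X | ∃ μ : ProbabilityMeasure X, IsErgodicMeasure T μ ∧
    (genericFiber T μ).Nonempty ∧ A = genericFiber T μ}

/-- Continuously pointwise ergodic: every point is generic for an ergodic measure and the
map `Φ` sending each point to that measure is continuous (weak-star topology). -/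
def ContinuouslyPointwiseErgodic (T : X ≃ₜ X) : Prop :=
  ∃ Φ : X → ProbabilityMeasure X, Continuous Φ ∧
    ∀ x : X, IsErgodicMeasure T (Φ x) ∧ IsGenericFor T x (Φ x)

/-- Continuously strictly pointwise ergodic = continuously pointwise ergodic +
semi-simple. -/
def ContinuouslyStrictlyPointwiseErgodic (T : X ≃ₜ X) : Prop :=
  ContinuouslyPointwiseErgodic T ∧ SemiSimple T

/-- The set `K` carries exactly one `T`-invariant Borel probability measure. -/
def UniquelyErgodicOn (T : X ≃ₜ X) (K : Set X) : Prop :=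
  ∃! μ : ProbabilityMeasure X, IsInvariantMeasure T μ ∧ μ.toMeasure K = 1

/-- Partitionable: `X` is a disjoint union of closed invariant uniquely ergodic sets. -/
def Partitionable (T : X ≃ₜ X) : Prop :=
  ∃ P : Set (Set X), IsPartition P ∧
    ∀ K ∈ P, IsClosed K ∧ IsInvariantSet T K ∧ UniquelyErgodicOn T K

/-- Strictly partitionable: `X` is a union of strictly ergodic (minimal and uniquely
ergodic) subsystems. -/
def StrictlyPartitionable (T : X ≃ₜ X) : Prop :=
  ∀ x : X, ∃ K : Set X, x ∈ K ∧ IsMinimalSet T K ∧ UniquelyErgodicOn T K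

/-- The topological support of a measure: points all of whose open neighborhoods have
positive measure (equivalently, the smallest closed set of full measure). -/
def msupp (μ : ProbabilityMeasure X) : Set X :=
  {x : X | ∀ U : Set X, IsOpen U → x ∈ U → 0 < μ.toMeasure U}

/-- The set `ℳ_T^e(X)` of ergodic invariant probability measures. -/
def ErgodicSet (T : X ≃ₜ X) : Set (ProbabilityMeasure X) :=
  {μ : ProbabilityMeasure X | IsErgodicMeasure T μ}

/-- Continuity of the set-valued map `supp : ℳ_T^e(X) → 2^X` (sequentially, via the
Hausdorff metric; `ℳ_T^e(X)` carries the weak-star topology, which is metrizable). -/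
def SuppContinuousOnErgodic (T : X ≃ₜ X) : Prop :=
  ∀ μ ∈ ErgodicSet T, ∀ ν : ℕ → ProbabilityMeasure X,
    (∀ n, ν n ∈ ErgodicSet T) → Tendsto ν atTop (𝓝 μ) →
    Tendsto (fun n => hausdorffDist (msupp (ν n)) (msupp μ)) atTop (𝓝 0)

end MeasDefs
section Helpers

lemma exists_sep_fun {X : Type*} [MetricSpace X] [CompactSpace X] (s : Setoid X)
    (hR : IsClosed {p : X × X | s p.1 p.2}) (x y : X) (hxy : ¬ s x y) :
    ∃ g : C(X, ℝ), (∀ a b, s a b → g a = g b) ∧ g x = 0 ∧ g y = 1 := by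
  have hclosed : IsClosedMap (Quotient.mk s) := by
    intro C hC
    refine isQuotientMap_quotient_mk'.isClosed_preimage.1 ?_
    change IsClosed ((Quotient.mk s) ⁻¹' ((Quotient.mk s) '' C))
    have : (Quotient.mk s) ⁻¹' ((Quotient.mk s) '' C)
        = Prod.snd '' ({p : X × X | s p.1 p.2} ∩ (Prod.fst ⁻¹' C)) := by
      ext b
      simp only [Set.mem_preimage, Set.mem_image, Set.mem_inter_iff, Set.mem_ofPred_eq,
        Prod.exists, exists_eq_right]
      constructor
      · rintro ⟨a, ha, hab⟩
        exact ⟨a, Quotient.exact hab, ha⟩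
      · rintro ⟨a, hab, ha⟩
        exact ⟨a, ha, Quotient.sound hab⟩
    rw [this]
    exact ((hR.inter (hC.preimage continuous_fst)).isCompact.image continuous_snd).isClosed
  have hcont : Continuous (Quotient.mk s) := continuous_quot_mk
  have hcl : ∀ q : Quotient s, IsClosed ((Quotient.mk s) ⁻¹' {q}) := by
    intro q
    obtain ⟨a, rfl⟩ := Quotient.exists_rep q
    have : IsClosed ({Quotient.mk s a} : Set (Quotient s)) := by
      have := hclosed {a} isClosed_singleton
      rwa [Set.image_singleton] at this
    exact this.preimage hcont
  haveI : T2Space (Quotient s) := by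
    refine ⟨fun p q hpq => ?_⟩
    have hd : Disjoint ((Quotient.mk s) ⁻¹' {p}) ((Quotient.mk s) ⁻¹' {q}) := by
      rw [Set.disjoint_left]
      intro a ha hb
      exact hpq (ha.symm.trans hb)
    obtain ⟨U, V, hU, hV, hpU, hqV, hUV⟩ := normal_separation (hcl p) (hcl q) hd
    refine ⟨((Quotient.mk s) '' Uᶜ)ᶜ, ((Quotient.mk s) '' Vᶜ)ᶜ,
      (hclosed _ hU.isClosed_compl).isOpen_compl, (hclosed _ hV.isClosed_compl).isOpen_compl,
      ?_, ?_, ?_⟩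
    · rintro ⟨a, ha, h⟩
      exact ha (hpU h)
    · rintro ⟨a, ha, h⟩
      exact ha (hqV h)
    · rw [Set.disjoint_left]
      intro z hz1 hz2
      obtain ⟨w, rfl⟩ := Quotient.exists_rep z
      have h1 : w ∈ U := by
        by_contra h
        exact hz1 ⟨w, h, rfl⟩
      have h2 : w ∈ V := by
        by_contra h
        exact hz2 ⟨w, h, rfl⟩
      exact Set.disjoint_left.1 hUV h1 h2
  have hne : Disjoint ({Quotient.mk s x} : Set (Quotient s)) {Quotient.mk s y} := by
    rw [Set.disjoint_singleton]
    exact fun h => hxy (Quotient.exact h)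
  obtain ⟨f, hf0, hf1, -⟩ := exists_continuous_zero_one_of_isClosed
    (isClosed_singleton (x := Quotient.mk s x)) (isClosed_singleton (x := Quotient.mk s y)) hne
  refine ⟨⟨fun a => f (Quotient.mk s a), f.continuous.comp hcont⟩, ?_, ?_, ?_⟩
  · intro a b hab
    change f _ = f _
    rw [Quotient.sound hab]
  · exact hf0 rfl
  · exact hf1 rfl

lemma exists_metric_quot {X : Type*} [MetricSpace X] [CompactSpace X] (s : Setoid X)
    (hR : IsClosed {p : X × X | s p.1 p.2}) :
    ∃ (Y : Type) (_ : MetricSpace Y) (_ : CompactSpace Y) (π : X → Y),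
      Continuous π ∧ Function.Surjective π ∧ ∀ x y, π x = π y ↔ s x y := by
  let E := {g : C(X, ℝ) // ∀ a b, s a b → g a = g b}
  haveI : Nonempty E := ⟨⟨0, fun _ _ _ => rfl⟩⟩
  let D : ℕ → E := TopologicalSpace.denseSeq E
  let p : X → (ℕ → ℝ) := fun x n => (D n).1 x
  have hp : Continuous p := continuous_pi fun n => (D n).1.continuous
  haveI : CompactSpace (Set.range p) := isCompact_iff_compactSpace.1 (isCompact_range hp)
  refine ⟨Set.range p, TopologicalSpace.metrizableSpaceMetric _, ‹_›, Set.rangeFactorization p,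
    hp.subtype_mk _, Set.rangeFactorization_surjective, fun x y => ?_⟩
  have h0 : Set.rangeFactorization p x = Set.rangeFactorization p y ↔ p x = p y := by
    rw [Subtype.ext_iff]; rfl
  rw [h0]
  constructor
  · intro h
    by_contra hxy
    obtain ⟨g, hg, hgx, hgy⟩ := exists_sep_fun s hR x y hxy
    obtain ⟨n, hn⟩ := (TopologicalSpace.denseRange_denseSeq E).exists_dist_lt
      (⟨g, hg⟩ : E) (by norm_num : (0 : ℝ) < 1 / 3)
    have hn' : dist g (D n).1 < 1 / 3 := hn
    have h1 := (ContinuousMap.dist_apply_le_dist (f := g) (g := (D n).1) x).trans_lt hn'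
    have h2 := (ContinuousMap.dist_apply_le_dist (f := g) (g := (D n).1) y).trans_lt hn'
    have h3 : (D n).1 x = (D n).1 y := congrFun h n
    rw [Real.dist_eq, abs_lt] at h1 h2
    rw [hgx] at h1
    rw [hgy] at h2
    linarith [h1.1, h1.2, h2.1, h2.2]
  · intro h
    funext n
    exact (D n).2 x y h

variable {X : Type*} [MetricSpace X] [CompactSpace X] [MeasurableSpace X] [BorelSpace X]

lemma measure_closed_one (T : X ≃ₜ X) {K : Set X} (hK : IsClosed K)
    (hTK : ∀ x ∈ K, T x ∈ K) {x : X} (hx : x ∈ K) {μ : ProbabilityMeasure X}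
    (h : IsGenericFor T x μ) : μ.toMeasure K = 1 := by
  let f : C(X, ℝ) := ⟨fun y => infDist y K, continuous_infDist_pt K⟩
  have hit : ∀ i, (⇑T)^[i] x ∈ K := by
    intro i
    induction i with
    | zero => exact hx
    | succ n ih => rw [Function.iterate_succ_apply']; exact hTK _ ih
  have hz : ∀ n, cesaro (⇑T) (⇑f) n x = 0 := by
    intro n
    have : ∑ i ∈ Finset.range n, f ((⇑T)^[i] x) = 0 :=
      Finset.sum_eq_zero fun i _ => infDist_zero_of_mem (hit i)
    simp [cesaro, this]
  have h0 : ∫ y, f y ∂μ.toMeasure = 0 := by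
    have := h f
    simp only [hz] at this
    exact (tendsto_nhds_unique this tendsto_const_nhds)
  have hint : Integrable (⇑f) μ.toMeasure :=
    (BoundedContinuousFunction.mkOfCompact f).integrable μ.toMeasure
  rw [integral_eq_zero_iff_of_nonneg (f := ⇑f) (fun y => infDist_nonneg) hint] at h0
  rw [prob_compl_eq_zero_iff hK.measurableSet |>.symm]
  refine measure_mono_null ?_ (ae_iff.1 h0)
  intro y hy h'
  exact hy ((hK.mem_iff_infDist_zero ⟨x, hx⟩).2 h')

lemma eq_of_integral_eq {μ ν : ProbabilityMeasure X}
    (h : ∀ f : C(X, ℝ), ∫ y, f y ∂μ.toMeasure = ∫ y, f y ∂ν.toMeasure) : μ = ν := by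
  apply Subtype.ext
  haveI : IsFiniteMeasure (μ : Measure X) := inferInstance
  haveI : IsFiniteMeasure (ν : Measure X) := inferInstance
  refine @ext_of_forall_integral_eq_of_IsFiniteMeasure _ _ _ _ _ (μ : Measure X) (ν : Measure X) _ _ ?_
  intro f
  exact h f.toContinuousMap

lemma generic_unique (T : X ≃ₜ X) {x : X} {μ ν : ProbabilityMeasure X}
    (h : IsGenericFor T x μ) (h' : IsGenericFor T x ν) : μ = ν :=
  eq_of_integral_eq fun f => tendsto_nhds_unique (h f) (h' f)

lemma inv_meas_unique (T : X ≃ₜ X) {μ ν : ProbabilityMeasure X} (hν : IsInvariantMeasure T ν)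
    (hK : ∀ᵐ x ∂ν.toMeasure, IsGenericFor T x μ) : ν = μ := by
  apply eq_of_integral_eq
  intro f
  have hmp : MeasurePreserving (⇑T) ν.toMeasure ν.toMeasure :=
    ⟨T.continuous.measurable, hν⟩
  have hint : Integrable (⇑f) ν.toMeasure :=
    (BoundedContinuousFunction.mkOfCompact f).integrable ν.toMeasure
  have hi : ∀ i, Integrable (fun x => f ((⇑T)^[i] x)) ν.toMeasure := fun i =>
    (hmp.iterate i).integrable_comp_of_integrable hint
  have he : ∀ i, ∫ x, f ((⇑T)^[i] x) ∂ν.toMeasure = ∫ x, f x ∂ν.toMeasure := by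
    intro i
    have h1 := (hmp.iterate i).map_eq
    conv_rhs => rw [← h1]
    rw [integral_map (hmp.iterate i).measurable.aemeasurable
      f.continuous.aestronglyMeasurable]
  have hces : ∀ n : ℕ, n ≠ 0 → ∫ x, cesaro (⇑T) (⇑f) n x ∂ν.toMeasure
      = ∫ x, f x ∂ν.toMeasure := by
    intro n hn
    simp only [cesaro]
    rw [integral_const_mul, integral_finsetSum _ (fun i _ => hi i)]
    simp only [he, Finset.sum_const, Finset.card_range, nsmul_eq_mul]
    field_simp
  have hlim : Tendsto (fun n => ∫ x, cesaro (⇑T) (⇑f) n x ∂ν.toMeasure) atTop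
      (𝓝 (∫ _x, (∫ y, f y ∂μ.toMeasure) ∂ν.toMeasure)) := by
    refine tendsto_integral_of_dominated_convergence (fun _ => ‖f‖) ?_ (integrable_const _) ?_ ?_
    · intro n
      exact ((integrable_finset_sum _ (fun i _ => hi i)).const_mul _).aestronglyMeasurable
    · intro n
      refine Eventually.of_forall fun x => ?_
      simp only [cesaro]
      rw [norm_mul, norm_inv, Real.norm_natCast]
      rcases eq_or_ne n 0 with rfl | hn
      · simp
      have h1 : ‖∑ i ∈ Finset.range n, f ((⇑T)^[i] x)‖ ≤ n * ‖f‖ := by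
        refine (norm_sum_le_of_le _ (fun i _ => f.norm_coe_le_norm _)).trans ?_
        simp
      have hn' : (0 : ℝ) < n := by positivity
      rw [inv_mul_le_iff₀ hn']
      exact h1
    · filter_upwards [hK] with x hx
      exact hx f
  have hlim2 : Tendsto (fun n => ∫ x, cesaro (⇑T) (⇑f) n x ∂ν.toMeasure) atTop
      (𝓝 (∫ x, f x ∂ν.toMeasure)) := by
    refine tendsto_const_nhds.congr' ?_
    filter_upwards [eventually_ne_atTop 0] with n hn
    exact (hces n hn).symm
  have := tendsto_nhds_unique hlim2 hlim
  simpa using this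

lemma generic_T (T : X ≃ₜ X) {x : X} {μ : ProbabilityMeasure X} (h : IsErgodicMeasure T μ)
    (hx : IsGenericFor T x μ) : IsGenericFor T (T x) μ := by
  intro f
  have hmp : MeasurePreserving (⇑T) μ.toMeasure μ.toMeasure := h.toMeasurePreserving
  let g : C(X, ℝ) := f.comp ⟨T, T.continuous⟩
  have h1 := hx g
  have h2 : ∫ y, g y ∂μ.toMeasure = ∫ y, f y ∂μ.toMeasure := by
    conv_rhs => rw [← hmp.map_eq]
    rw [integral_map hmp.measurable.aemeasurable f.continuous.aestronglyMeasurable]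
    rfl
  rw [h2] at h1
  refine h1.congr fun n => ?_
  simp only [cesaro]
  congr 1
  refine Finset.sum_congr rfl fun i _ => ?_
  change f (T ((⇑T)^[i] x)) = _
  rw [← Function.iterate_succ_apply' (⇑T), Function.iterate_succ_apply]

lemma generic_T_iff (T : X ≃ₜ X) (hpe : PointwiseErgodic T) {x : X} {μ : ProbabilityMeasure X} :
    IsGenericFor T (T x) μ ↔ IsErgodicMeasure T μ ∧ IsGenericFor T x μ := by
  constructor
  · intro h
    obtain ⟨ν, hν, hx⟩ := hpe x
    have := generic_unique T h (generic_T T hν hx)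
    subst this
    exact ⟨hν, hx⟩
  · exact fun h => generic_T T h.1 h.2

lemma hausdorff_mem {A : Set X} {S : Set X} (hA : A.Nonempty) (hS : S.Nonempty) {r : ℝ}
    (h : hausdorffDist A S < r) {z : X} (hz : z ∈ S) : ∃ a ∈ A, dist a z < r :=
  exists_dist_lt_of_hausdorffDist_lt' hz h
    (hausdorffEDist_ne_top_of_nonempty_of_bounded hA hS
      (isCompact_univ.isBounded.subset (Set.subset_univ _))
      (isCompact_univ.isBounded.subset (Set.subset_univ _)))

lemma hausdorff_seq {A : ℕ → Set X} {S : Set X} (hA : ∀ n, (A n).Nonempty) (hS : S.Nonempty)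
    (h : Tendsto (fun n => hausdorffDist (A n) S) atTop (𝓝 0)) {z : X} (hz : z ∈ S) :
    ∃ a : ℕ → X, (∀ n, a n ∈ A n) ∧ Tendsto a atTop (𝓝 z) := by
  have : ∀ n : ℕ, ∃ a ∈ A n, dist a z < hausdorffDist (A n) S + 1 / ((n : ℝ) + 1) := fun n =>
    hausdorff_mem (hA n) hS (by have : (0 : ℝ) < 1 / ((n : ℝ) + 1) := by positivity
                                linarith) hz
  choose a ha hd using this
  refine ⟨a, ha, ?_⟩
  rw [tendsto_iff_dist_tendsto_zero]
  refine squeeze_zero (fun _ => dist_nonneg) (fun n => (hd n).le) ?_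
  simpa using h.add tendsto_one_div_add_atTop_nhds_zero_nat

end Helpers

lemma invariant_fiber {X Y : Type*} [MetricSpace X] (T : X ≃ₜ X) {π : X → Y}
    (hπT : ∀ x, π (T x) = π x) (y : Y) : IsInvariantSet T (π ⁻¹' {y}) := by
  ext z
  constructor
  · rintro ⟨w, hw, rfl⟩
    exact (hπT w).trans hw
  · intro hz
    refine ⟨T.symm z, ?_, T.apply_symm_apply z⟩
    have := hπT (T.symm z)
    rw [T.apply_symm_apply] at this
    exact this.symm.trans hz

/-- for a pointwise ergodic system, `𝒫` has closed atoms and is upper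
semicontinuous iff there is a continuous surjection `π` onto a compact metric space `Y`
with `π ∘ T = π` whose fibers are closed invariant uniquely ergodic sets. -/
theorem stmt_8 {X : Type*} [MetricSpace X] [CompactSpace X]
    [MeasurableSpace X] [BorelSpace X] (T : X ≃ₜ X)
    (hpe : PointwiseErgodic T) :
    ((∀ A ∈ genericPartition T, IsClosed A) ∧ PartitionUSC (genericPartition T)) ↔
      ∃ (Y : Type) (_ : MetricSpace Y) (_ : CompactSpace Y) (π : X → Y),
        Continuous π ∧ Function.Surjective π ∧ (∀ x : X, π (T x) = π x) ∧
        ∀ y : Y, IsClosed (π ⁻¹' {y}) ∧ IsInvariantSet T (π ⁻¹' {y}) ∧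
          UniquelyErgodicOn T (π ⁻¹' {y}) := by
  constructor
  · rintro ⟨hcl, husc⟩
    choose Φ hΦe hΦg using hpe
    let s : Setoid X := Setoid.ker Φ
    have hs : ∀ x y, s x y ↔ Φ x = Φ y := fun x y => Iff.rfl
    have hfib : ∀ x y, y ∈ genericFiber T (Φ x) ↔ Φ x = Φ y := by
      intro x y
      constructor
      · intro h
        exact generic_unique T h (hΦg y)
      · intro h
        change IsGenericFor T y (Φ x)
        rw [h]
        exact hΦg y
    have hP : ∀ x, genericFiber T (Φ x) ∈ genericPartition T := fun x =>
      ⟨Φ x, hΦe x, ⟨x, hΦg x⟩, rfl⟩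
    have hR : IsClosed {p : X × X | s p.1 p.2} := by
      apply IsSeqClosed.isClosed
      intro u p hu hup
      let K : ℕ → TopologicalSpace.NonemptyCompacts X := fun n =>
        ⟨⟨genericFiber T (Φ (u n).1), (hcl _ (hP _)).isCompact⟩, ⟨(u n).1, hΦg _⟩⟩
      obtain ⟨S, φ, hφ, hS⟩ := CompactSpace.tendsto_subseq K
      have hd : Tendsto (fun n => hausdorffDist (K (φ n) : Set X) (S : Set X)) atTop (𝓝 0) :=
        tendsto_iff_dist_tendsto_zero.1 hS
      have hup' := hup.comp hφ.tendsto_atTop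
      have key : ∀ (v : ℕ → X) (z : X), (∀ n, v n ∈ (K (φ n) : Set X)) →
          Tendsto v atTop (𝓝 z) → z ∈ (S : Set X) := by
        intro v z hv hvz
        rw [S.isCompact.isClosed.mem_iff_infDist_zero S.nonempty]
        have hle : ∀ n, infDist z (S : Set X) ≤
            dist z (v n) + hausdorffDist (K (φ n) : Set X) (S : Set X) := by
          intro n
          have h1 := infDist_le_infDist_add_dist (s := (S : Set X)) (x := z) (y := v n)
          have h2 := infDist_le_hausdorffDist_of_mem (hv n)
            (hausdorffEDist_ne_top_of_nonempty_of_bounded (K (φ n)).nonempty S.nonempty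
              (K (φ n)).isCompact.isBounded S.isCompact.isBounded)
          linarith
        have h0 : Tendsto (fun n => dist z (v n) +
            hausdorffDist (K (φ n) : Set X) (S : Set X)) atTop (𝓝 0) := by
          have := (tendsto_const_nhds (x := z)).dist hvz
          rw [dist_self] at this
          simpa using this.add hd
        exact le_antisymm (ge_of_tendsto' h0 hle) infDist_nonneg
      have h1 : p.1 ∈ (S : Set X) := key (fun n => (u (φ n)).1) p.1 (fun n => hΦg _)
        ((continuous_fst.tendsto p).comp hup')
      have h2 : p.2 ∈ (S : Set X) := key (fun n => (u (φ n)).2) p.2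
        (fun n => (hfib _ _).2 (hu (φ n))) ((continuous_snd.tendsto p).comp hup')
      obtain ⟨B, ⟨μ, hμ, -, rfl⟩, hSB⟩ := husc (fun n => (K (φ n) : Set X)) (fun n => hP _)
        S S.nonempty S.isCompact hd
      change Φ p.1 = Φ p.2
      rw [← generic_unique T (hSB h1) (hΦg p.1), ← generic_unique T (hSB h2) (hΦg p.2)]
    obtain ⟨Y, i1, i2, π, hπ, hsurj, hker⟩ := exists_metric_quot s hR
    have hT : ∀ x, Φ (T x) = Φ x := fun x =>
      generic_unique T (hΦg (T x)) (generic_T T (hΦe x) (hΦg x))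
    have hπT : ∀ x, π (T x) = π x := fun x => (hker _ _).2 (hT x)
    refine ⟨Y, i1, i2, π, hπ, hsurj, hπT, fun y => ?_⟩
    have hc : IsClosed (π ⁻¹' {y}) := isClosed_singleton.preimage hπ
    refine ⟨hc, ?_, ?_⟩
    · exact invariant_fiber T hπT y
    · obtain ⟨x, rfl⟩ := hsurj y
      refine ⟨Φ x, ⟨(hΦe x).toMeasurePreserving.map_eq, ?_⟩, ?_⟩
      · exact measure_closed_one T hc (fun z hz => (hπT z).trans hz) rfl (hΦg x)
      · rintro ν ⟨hν, hν1⟩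
        apply inv_meas_unique T hν
        have : ∀ᵐ z ∂ν.toMeasure, z ∈ π ⁻¹' {π x} := by
          rw [ae_iff]
          exact (prob_compl_eq_zero_iff hc.measurableSet).2 hν1
        filter_upwards [this] with z hz
        exact (hfib x z).2 ((hker _ _).1 hz).symm
  · rintro ⟨Y, i1, i2, π, hπ, hsurj, hπT, hY⟩
    have hone : ∀ x μ, IsGenericFor T x μ → μ.toMeasure (π ⁻¹' {π x}) = 1 := fun x μ h =>
      measure_closed_one T (hY _).1 (fun z hz => (hπT z).trans hz) rfl h
    have hfib : ∀ x μ, IsErgodicMeasure T μ → IsGenericFor T x μ →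
        genericFiber T μ = π ⁻¹' {π x} := by
      intro x μ hμ hx
      ext z
      constructor
      · intro hz
        have h1 := hone x μ hx
        have h2 := hone z μ hz
        by_contra hne
        have hd : π ⁻¹' {π z} ⊆ (π ⁻¹' {π x})ᶜ := by
          intro w hw hw'
          exact hne (hw.symm.trans hw')
        have h3 := measure_mono_null hd
          ((prob_compl_eq_zero_iff (hY (π x)).1.measurableSet).2 h1)
        rw [h2] at h3
        exact one_ne_zero h3
      · intro hz
        obtain ⟨ν, hν, hzν⟩ := hpe z
        have hz' : π z = π x := hz
        have h2 := hone z ν hzν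
        rw [hz'] at h2
        have : μ = ν := (hY (π x)).2.2.unique ⟨hμ.toMeasurePreserving.map_eq, hone x μ hx⟩
          ⟨hν.toMeasurePreserving.map_eq, h2⟩
        rw [this]
        exact hzν
    have hat : ∀ A ∈ genericPartition T, ∃ x, A = π ⁻¹' {π x} := by
      rintro A ⟨μ, hμ, ⟨x, hx⟩, rfl⟩
      exact ⟨x, hfib x μ hμ hx⟩
    refine ⟨?_, ?_⟩
    · intro A hA
      obtain ⟨x, rfl⟩ := hat A hA
      exact (hY _).1
    · intro A hA S hS hSc hlim
      obtain ⟨s, hs⟩ := hS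
      obtain ⟨μ, hμ, hsμ⟩ := hpe s
      refine ⟨genericFiber T μ, ⟨μ, hμ, ⟨s, hsμ⟩, rfl⟩, ?_⟩
      rw [hfib s μ hμ hsμ]
      intro z hz
      have hne : ∀ n, (A n).Nonempty := by
        intro n
        obtain ⟨μ, -, h, h'⟩ := hA n
        rw [h']
        exact h
      obtain ⟨a, ha, hal⟩ := hausdorff_seq hne ⟨s, hs⟩ hlim hs
      obtain ⟨b, hb, hbl⟩ := hausdorff_seq hne ⟨s, hs⟩ hlim hz
      have hab : ∀ n, π (a n) = π (b n) := by
        intro n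
        obtain ⟨x, hx⟩ := hat _ (hA n)
        have h1 := ha n
        have h2 := hb n
        rw [hx] at h1 h2
        exact Eq.trans h1 (Eq.symm h2)
      have h1 := (hπ.tendsto s).comp hal
      have h2 := (hπ.tendsto z).comp hbl
      have h3 : π ∘ a = π ∘ b := funext hab
      rw [h3] at h1
      exact tendsto_nhds_unique h2 h1
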